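/- arXiv:1809.00761 — 3 statements merged into one kernel-verified Lean document; each statement's English description precedes it below -/
import Mathlib

section
/- Let X be a real Hilbert space, let A: X ⇒ X be α-monotone, let γ > 0, and let J: X → X satisfy x − J x ∈ γ·A(J x) for all x ∈ X. Let λ ≥ 0, define R := (1−λ)·Id + λ·J, and let ε ∈ ℝ with ε ≤ λ − 1; define Q := R + ε·Id. Then for all x, y ∈ X, ‖Qx − Qy‖² ≤ (λ − 1 − ε)²‖x − y‖² − λ((λ−1)(2 + 2γα) − λ − 2ε(1+γα))‖Jx − Jy‖². Consequently, if additionally (λ−1)(2 + 2γα) − λ − 2ε(1+γα) ≥ 0, then Q is Lipschitz continuous with constant λ − 1 − ε. -/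
open Pointwise RealInnerProductSpace Filter

variable {X : Type*} [NormedAddCommGroup X] [InnerProductSpace ℝ X]

/-- `A` is `α`-monotone: `⟪x - y, u - v⟫ ≥ α‖x - y‖²` for all `(x,u), (y,v)` in the graph. -/
def AlphaMonotone (α : ℝ) (A : X → Set X) : Prop :=
  ∀ ⦃x y u v : X⦄, u ∈ A x → v ∈ A y → α * ‖x - y‖ ^ 2 ≤ ⟪x - y, u - v⟫

/-- `A` is maximally `α`-monotone: it is `α`-monotone and no `α`-monotone operator has a graph
properly containing the graph of `A`. -/
def MaxAlphaMonotone (α : ℝ) (A : X → Set X) : Prop :=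
  AlphaMonotone α A ∧
    ∀ B : X → Set X, AlphaMonotone α B → (∀ x, A x ⊆ B x) → ∀ x, B x ⊆ A x

/-- A selection `J` of the resolvent of `γ A`, with `A` `α`-monotone, is `(1 + γ α)`-cocoercive. -/
theorem AlphaMonotone.inner_resolvent_ge {A : X → Set X} {α : ℝ} (hA : AlphaMonotone α A)
    {γ : ℝ} (hγ : 0 ≤ γ) {J : X → X} (hJ : ∀ x, x - J x ∈ γ • A (J x)) (x y : X) :
    (1 + γ * α) * ‖J x - J y‖ ^ 2 ≤ ⟪x - y, J x - J y⟫ := by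
  obtain ⟨u, hu, hxu⟩ := Set.mem_smul_set.mp (hJ x)
  obtain ⟨v, hv, hyv⟩ := Set.mem_smul_set.mp (hJ y)
  have hd : x - y = γ • (u - v) + (J x - J y) := by
    rw [smul_sub, hxu, hyv]
    abel
  have hmono := mul_le_mul_of_nonneg_left (hA hu hv) hγ
  rw [hd, inner_add_left, real_inner_smul_left, real_inner_self_eq_norm_sq,
    real_inner_comm (J x - J y) (u - v)]
  linarith

theorem stmt11 (A : X → Set X) (α : ℝ) (hA : AlphaMonotone α A)
    (γ : ℝ) (hγ : 0 < γ)
    (J : X → X) (hJ : ∀ x, x - J x ∈ γ • A (J x))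
    (lam : ℝ) (hlam : 0 ≤ lam) (ε : ℝ) (hε : ε ≤ lam - 1) :
    let Q : X → X := fun x => ((1 - lam) • x + lam • J x) + ε • x
    (∀ x y : X,
        ‖Q x - Q y‖ ^ 2 ≤ (lam - 1 - ε) ^ 2 * ‖x - y‖ ^ 2 -
          lam * ((lam - 1) * (2 + 2 * γ * α) - lam - 2 * ε * (1 + γ * α)) * ‖J x - J y‖ ^ 2) ∧
      (0 ≤ (lam - 1) * (2 + 2 * γ * α) - lam - 2 * ε * (1 + γ * α) →
        ∀ x y : X, ‖Q x - Q y‖ ≤ (lam - 1 - ε) * ‖x - y‖) := by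
  intro Q
  have key : ∀ x y : X,
      ‖Q x - Q y‖ ^ 2 ≤ (lam - 1 - ε) ^ 2 * ‖x - y‖ ^ 2 -
        lam * ((lam - 1) * (2 + 2 * γ * α) - lam - 2 * ε * (1 + γ * α)) * ‖J x - J y‖ ^ 2 := by
    intro x y
    have hQ : Q x - Q y = lam • (J x - J y) - (lam - 1 - ε) • (x - y) := by
      simp only [Q]
      module
    have hcoef : 0 ≤ 2 * (lam * (lam - 1 - ε)) :=
      mul_nonneg zero_le_two (mul_nonneg hlam (by linarith))
    have hinner := mul_le_mul_of_nonneg_left (hA.inner_resolvent_ge hγ.le hJ x y) hcoef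
    rw [hQ, norm_sub_sq_real, real_inner_smul_left, real_inner_smul_right, norm_smul, norm_smul,
      mul_pow, mul_pow, Real.norm_eq_abs, Real.norm_eq_abs, sq_abs, sq_abs,
      real_inner_comm (x - y) (J x - J y)]
    linarith
  refine ⟨key, fun h x y => ?_⟩
  refine le_of_abs_le (abs_le_of_sq_le_sq ?_ (mul_nonneg (by linarith) (norm_nonneg _)))
  rw [mul_pow]
  exact (key x y).trans (sub_le_self _ (mul_nonneg (mul_nonneg hlam h) (sq_nonneg _)))
end

section
/- Let X be a real Hilbert space and suppose A: X ⇒ X is maximally α-monotone and B: X ⇒ X is maximally β-monotone with α + β ≥ 0. Then there exist γ, δ > 0 and λ, μ > 1 such that 1 + 2γα > 0, 2 − 2γβ ≤ μ ≤ 2 + 2γα, (λ−1)(μ−1) = 1, and δ = (λ−1)γ. Moreover, for any γ, δ > 0 and λ, μ > 1 satisfying these four conditions, one has 1 + γα > 0 and 1 + δβ > 0, and the resolvents are single-valued with full domain: for every x ∈ X there is a unique a ∈ X with x − a ∈ γ·A a, and a unique b ∈ X with x − b ∈ δ·B b. -/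
open Pointwise RealInnerProductSpace Filter

variable {X : Type*} [NormedAddCommGroup X] [InnerProductSpace ℝ X]

/-- Minimizing `t + ‖z‖² / 2` over a closed convex set of pairs `(z, t)`, together with the
first-order optimality condition at the minimizer. -/
theorem exists_minimizer_add_half_norm_sq {H : Type*} [NormedAddCommGroup H]
    [InnerProductSpace ℝ H] [CompleteSpace H] {S : Set (H × ℝ)} (hne : S.Nonempty)
    (hc : IsClosed S) (hconv : Convex ℝ S) (hpos : ∀ p ∈ S, 0 ≤ p.2 + ‖p.1‖ ^ 2 / 2) :
    ∃ p ∈ S, ∀ q ∈ S, p.2 + ‖p.1‖ ^ 2 ≤ q.2 + ⟪p.1, q.1⟫ := by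
  set f : H × ℝ → ℝ := fun p => p.2 + ‖p.1‖ ^ 2 / 2 with hf
  set m := sInf (f '' S)
  have hbdd : BddBelow (f '' S) := ⟨0, by rintro _ ⟨p, hp, rfl⟩; exact hpos p hp⟩
  have hm : ∀ p ∈ S, m ≤ f p := fun p hp => csInf_le hbdd ⟨p, hp, rfl⟩
  have hseq : ∀ n : ℕ, ∃ p ∈ S, f p < m + 1 / ((n : ℝ) + 1) := by
    intro n
    obtain ⟨_, ⟨p, hp, rfl⟩, hlt⟩ := exists_lt_of_csInf_lt (hne.image f)
      (show sInf (f '' S) < m + 1 / ((n : ℝ) + 1) from lt_add_of_pos_right _ (by positivity))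
    exact ⟨p, hp, hlt⟩
  choose p hpS hpf using hseq
  have key : ∀ q ∈ S, ∀ r ∈ S, ‖q.1 - r.1‖ ^ 2 ≤ 4 * (f q - m) + 4 * (f r - m) := by
    intro q hq r hr
    have h1 := hm _ (hconv hq hr (a := 1 / 2) (b := 1 / 2) (by norm_num) (by norm_num)
      (by norm_num))
    simp only [hf, Prod.fst_add, Prod.snd_add, Prod.smul_fst, Prod.smul_snd, smul_eq_mul,
      ← smul_add, norm_smul, mul_pow] at h1 ⊢
    norm_num at h1
    have h2 := parallelogram_law_with_norm ℝ q.1 r.1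
    nlinarith
  have hcau : CauchySeq fun n => (p n).1 := by
    refine cauchySeq_of_le_tendsto_0 (fun N : ℕ => √(8 * (1 / ((N : ℝ) + 1)))) ?_ ?_
    · intro n k N hn hk
      rw [dist_eq_norm]
      refine Real.le_sqrt_of_sq_le ((key _ (hpS n) _ (hpS k)).trans ?_)
      have h1 := (hpf n).trans_le (add_le_add_right (Nat.one_div_le_one_div (α := ℝ) hn) m)
      have h2 := (hpf k).trans_le (add_le_add_right (Nat.one_div_le_one_div (α := ℝ) hk) m)
      linarith
    · have h := (tendsto_one_div_add_atTop_nhds_zero_nat (𝕜 := ℝ)).const_mul 8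
      simpa using h.sqrt
  obtain ⟨z, hz⟩ := cauchySeq_tendsto_of_complete hcau
  have hfm : Tendsto (fun n => f (p n)) atTop (nhds m) := by
    refine tendsto_of_tendsto_of_tendsto_of_le_of_le tendsto_const_nhds ?_
      (fun n => hm _ (hpS n)) (fun n => (hpf n).le)
    simpa using (tendsto_one_div_add_atTop_nhds_zero_nat (𝕜 := ℝ)).const_add m
  have ht : Tendsto (fun n => (p n).2) atTop (nhds (m - ‖z‖ ^ 2 / 2)) := by
    refine (hfm.sub ((hz.norm.pow 2).div_const 2)).congr fun n => ?_
    simp [hf]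
  have hmem : (z, m - ‖z‖ ^ 2 / 2) ∈ S :=
    hc.mem_of_tendsto (hz.prodMk_nhds ht) (Eventually.of_forall hpS)
  refine ⟨_, hmem, fun q hq => ?_⟩
  by_contra! hlt
  set K := ‖q.1 - z‖ ^ 2 with hK
  set d := q.2 + ⟪z, q.1⟫ - (m - ‖z‖ ^ 2 / 2 + ‖z‖ ^ 2) with hd
  have hd0 : d < 0 := by simp only [hd]; linarith
  have hK0 : 0 ≤ K := by positivity
  have hKd : 0 < K - d := by linarith
  have hs : ∀ s : ℝ, 0 ≤ s → s ≤ 1 → 0 ≤ s * d + s ^ 2 * K / 2 := by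
    intro s hs0 hs1
    have h1 := hm _ (hconv.add_smul_sub_mem hmem hq ⟨hs0, hs1⟩)
    simp only [hf, Prod.fst_add, Prod.snd_add, Prod.smul_fst, Prod.smul_snd, smul_eq_mul,
      Prod.fst_sub, Prod.snd_sub] at h1
    rw [norm_add_sq_real, norm_smul, mul_pow, real_inner_smul_right, inner_sub_right,
      real_inner_self_eq_norm_sq, Real.norm_eq_abs, sq_abs] at h1
    simp only [hd, hK]
    linarith
  have h1 := hs (-d / (K - d)) (div_nonneg (by linarith) hKd.le)
    ((div_le_one hKd).2 (by linarith))
  have h2 : -d / (K - d) * d + (-d / (K - d)) ^ 2 * K / 2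
      = -(d ^ 2 * (K - 2 * d)) / (2 * (K - d) ^ 2) := by
    field_simp
    ring
  rw [h2] at h1
  have h3 : 0 < d ^ 2 * (K - 2 * d) / (2 * (K - d) ^ 2) := by
    have : 0 < K - 2 * d := by linarith
    have : 0 < d ^ 2 := by nlinarith
    positivity
  rw [neg_div] at h1
  linarith

theorem MaxAlphaMonotone.mem_of_forall {α : ℝ} {A : X → Set X} (hA : MaxAlphaMonotone α A)
    {a b : X} (h : ∀ y v, v ∈ A y → α * ‖a - y‖ ^ 2 ≤ ⟪a - y, b - v⟫) : b ∈ A a := by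
  refine hA.2 (fun x => {u | u ∈ A x ∨ x = a ∧ u = b}) ?_ (fun x u hu => Or.inl hu) a
    (Or.inr ⟨rfl, rfl⟩)
  rintro x y u v (hu | ⟨rfl, rfl⟩) (hv | ⟨rfl, rfl⟩)
  · exact hA.1 hu hv
  · have := h x u hu
    rwa [norm_sub_rev, ← neg_sub x, ← neg_sub u, inner_neg_neg] at this
  · exact h y v hv
  · simp

/-- Minty's theorem, proved through the Fitzpatrick function of `A`. -/
theorem MaxAlphaMonotone.exists_neg_mem [CompleteSpace X] {A : X → Set X}
    (hA : MaxAlphaMonotone 0 A) : ∃ a, -a ∈ A a := by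
  have hmon : ∀ {x y u v : X}, u ∈ A x → v ∈ A y → 0 ≤ ⟪x - y, u - v⟫ := fun hu hv => by
    simpa using hA.1 hu hv
  have hmax : ∀ {a b : X}, (∀ y v, v ∈ A y → 0 ≤ ⟪a - y, b - v⟫) → b ∈ A a := fun h =>
    hA.mem_of_forall (by simpa using h)
  set S : Set (WithLp 2 (X × X) × ℝ) :=
    {p | ∀ y v, v ∈ A y → ⟪p.1.fst, v⟫ + ⟪y, p.1.snd⟫ - ⟪y, v⟫ ≤ p.2} with hS
  have hgraph : ∀ {y v}, v ∈ A y → ((WithLp.toLp 2 (y, v), ⟪y, v⟫) : _ × ℝ) ∈ S := by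
    intro y v hv y' v' hv'
    have := hmon hv hv'
    simp only [inner_sub_left, inner_sub_right] at this
    change ⟪y, v'⟫ + ⟪y', v⟫ - ⟪y', v'⟫ ≤ ⟪y, v⟫
    linarith
  have hle : ∀ p ∈ S, ⟪p.1.fst, p.1.snd⟫ ≤ p.2 := by
    intro p hp
    by_contra! hlt
    have hmem : p.1.snd ∈ A p.1.fst := hmax fun y v hv => by
      have := hp y v hv
      simp only [inner_sub_left, inner_sub_right]
      linarith
    have := hp _ _ hmem
    linarith
  have hne : S.Nonempty := by
    by_contra hem
    have hno : ∀ y v, v ∉ A y := fun y v hv => hem ⟨_, hgraph hv⟩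
    exact hno 0 0 (hmax fun y v hv => (hno y v hv).elim)
  have hcl : IsClosed S := by
    simp only [hS, Set.ofPred_forall]
    refine isClosed_iInter fun y => isClosed_iInter fun v => isClosed_iInter fun _ =>
      isClosed_le ?_ continuous_snd
    fun_prop
  have hconv : Convex ℝ S := by
    intro p hp q hq s t hs ht hst y v hv
    have h1 := mul_le_mul_of_nonneg_left (hp y v hv) hs
    have h2 := mul_le_mul_of_nonneg_left (hq y v hv) ht
    simp only [Prod.fst_add, Prod.snd_add, Prod.smul_fst, Prod.smul_snd, smul_eq_mul,
      WithLp.add_fst, WithLp.add_snd, WithLp.smul_fst, WithLp.smul_snd, inner_add_left,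
      inner_add_right, real_inner_smul_left, real_inner_smul_right]
    have h3 : ⟪y, v⟫ = (s + t) * ⟪y, v⟫ := by rw [hst, one_mul]
    rw [h3]
    linarith
  have hpos : ∀ p ∈ S, 0 ≤ p.2 + ‖p.1‖ ^ 2 / 2 := by
    intro p hp
    have h1 := hle p hp
    have h2 := norm_add_sq_real p.1.fst p.1.snd
    rw [WithLp.prod_norm_sq_eq_of_L2]
    nlinarith [sq_nonneg ‖p.1.fst + p.1.snd‖]
  obtain ⟨⟨z, t⟩, hp, hopt⟩ := exists_minimizer_add_half_norm_sq hne hcl hconv hpos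
  have hab : ⟪z.fst, z.snd⟫ ≤ t := hle _ hp
  have hrel : ∀ y v, v ∈ A y → ‖z.fst + z.snd‖ ^ 2 ≤ ⟪-z.snd - y, -z.fst - v⟫ := by
    intro y v hv
    have h1 := hopt _ (hgraph hv)
    rw [WithLp.prod_norm_sq_eq_of_L2, WithLp.prod_inner_apply] at h1
    change t + (‖z.fst‖ ^ 2 + ‖z.snd‖ ^ 2) ≤ ⟪y, v⟫ + (⟪z.fst, y⟫ + ⟪z.snd, v⟫) at h1
    rw [norm_add_sq_real]
    simp only [inner_sub_left, inner_sub_right, inner_neg_left, inner_neg_right] at h1 ⊢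
    rw [real_inner_comm z.fst z.snd, real_inner_comm z.fst y]
    linarith
  have hmem : -z.fst ∈ A (-z.snd) := hmax fun y v hv => (sq_nonneg _).trans (hrel y v hv)
  have h0 := hrel _ _ hmem
  simp only [sub_self, inner_zero_left] at h0
  have h1 : z.fst + z.snd = 0 :=
    norm_eq_zero.1 (pow_eq_zero_iff two_ne_zero |>.1 (le_antisymm h0 (sq_nonneg _)))
  exact ⟨-z.snd, by rwa [eq_neg_of_add_eq_zero_left h1] at hmem⟩

/-- The resolvent of a maximally `α`-monotone operator is single-valued with full domain. -/
theorem MaxAlphaMonotone.existsUnique_resolvent [CompleteSpace X] {α γ : ℝ} {A : X → Set X}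
    (hA : MaxAlphaMonotone α A) (hγ : 0 < γ) (hc : 0 < 1 + γ * α) (x : X) :
    ∃! a : X, x - a ∈ γ • A a := by
  set c := 1 + γ * α with hcdef
  have hscale : ∀ d s r : X,
      ⟪d, (α • d + γ⁻¹ • c • (s - r))⟫ - α * ‖d‖ ^ 2 = γ⁻¹ * c * ⟪d, s - r⟫ := by
    intro d s r
    rw [inner_add_right, real_inner_smul_right, real_inner_smul_right, real_inner_smul_right,
      real_inner_self_eq_norm_sq]
    ring
  have hT : MaxAlphaMonotone 0 fun y => {t | α • y + γ⁻¹ • (c • t + x) ∈ A y} := by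
    have hdiff : ∀ y y' t t' : X, α • y + γ⁻¹ • (c • t + x) - (α • y' + γ⁻¹ • (c • t' + x))
        = α • (y - y') + γ⁻¹ • c • (t - t') := by
      intros
      module
    have hk : 0 < γ⁻¹ * c := by positivity
    constructor
    · intro y y' t t' ht ht'
      have h1 := hA.1 ht ht'
      rw [hdiff, ← sub_nonneg, hscale] at h1
      rw [zero_mul]
      exact nonneg_of_mul_nonneg_right h1 hk
    · intro B hB hAB y t ht
      refine hA.mem_of_forall fun y' v hv => ?_
      obtain ⟨t', rfl⟩ : ∃ t', α • y' + γ⁻¹ • (c • t' + x) = v := by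
        refine ⟨c⁻¹ • (γ • (v - α • y') - x), ?_⟩
        rw [smul_inv_smul₀ hc.ne', sub_add_cancel, inv_smul_smul₀ hγ.ne', add_sub_cancel]
      rw [hdiff, ← sub_nonneg, hscale]
      exact mul_nonneg hk.le (by simpa using hB ht (hAB y' hv))
  obtain ⟨a, ha⟩ := hT.exists_neg_mem
  have hmem : ∀ b, x - b ∈ γ • A b ↔ γ⁻¹ • (x - b) ∈ A b := fun b =>
    Set.mem_smul_set_iff_inv_smul_mem₀ hγ.ne' _ _
  have ha' : γ⁻¹ • (x - a) ∈ A a := by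
    have h1 : α • a + γ⁻¹ • (c • -a + x) = γ⁻¹ • (x - a) := by
      have : α • a = γ⁻¹ • (γ * α) • a := by rw [mul_smul, inv_smul_smul₀ hγ.ne']
      rw [this, hcdef]
      module
    simpa only [Set.mem_ofPred_eq, h1] using ha
  refine ⟨a, (hmem a).2 ha', fun b hb => ?_⟩
  have h1 := hA.1 ((hmem b).1 hb) ha'
  have h2 : γ⁻¹ • (x - b) - γ⁻¹ • (x - a) = -(γ⁻¹ • (b - a)) := by module
  rw [h2, inner_neg_right, real_inner_smul_right, real_inner_self_eq_norm_sq] at h1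
  have h3 : c * ‖b - a‖ ^ 2 ≤ 0 := by
    have := mul_le_mul_of_nonneg_left h1 hγ.le
    have h4 : γ * -(γ⁻¹ * ‖b - a‖ ^ 2) = -‖b - a‖ ^ 2 := by field_simp
    rw [h4] at this
    rw [hcdef]
    linarith
  have h4 : ‖b - a‖ ^ 2 = 0 := le_antisymm (nonpos_of_mul_nonpos_right h3 hc) (sq_nonneg _)
  exact sub_eq_zero.1 (norm_eq_zero.1 (pow_eq_zero_iff two_ne_zero |>.1 h4))

theorem stmt16 [CompleteSpace X] (A B : X → Set X) (α β : ℝ)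
    (hA : MaxAlphaMonotone α A) (hB : MaxAlphaMonotone β B) (hαβ : 0 ≤ α + β) :
    (∃ γ δ lam μ : ℝ, 0 < γ ∧ 0 < δ ∧ 1 < lam ∧ 1 < μ ∧
        0 < 1 + 2 * γ * α ∧ 2 - 2 * γ * β ≤ μ ∧ μ ≤ 2 + 2 * γ * α ∧
        (lam - 1) * (μ - 1) = 1 ∧ δ = (lam - 1) * γ) ∧
      ∀ γ δ lam μ : ℝ, 0 < γ → 0 < δ → 1 < lam → 1 < μ →
        0 < 1 + 2 * γ * α → 2 - 2 * γ * β ≤ μ → μ ≤ 2 + 2 * γ * α →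
        (lam - 1) * (μ - 1) = 1 → δ = (lam - 1) * γ →
        0 < 1 + γ * α ∧ 0 < 1 + δ * β ∧
          (∀ x : X, ∃! a : X, x - a ∈ γ • A a) ∧
          (∀ x : X, ∃! b : X, x - b ∈ δ • B b) := by
  constructor
  · have hγ : 0 < (2 * (1 + |α|))⁻¹ := by positivity
    set γ := (2 * (1 + |α|))⁻¹ with hγdef
    have hα : 0 < 1 + 2 * γ * α := by
      have h1 : 2 * γ * (1 + |α|) = 1 := by rw [hγdef]; field_simp
      have h2 : 0 ≤ 2 * γ * (|α| + α) :=
        mul_nonneg (by positivity) (by linarith [neg_abs_le α])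
      linarith
    refine ⟨γ, (1 + 2 * γ * α)⁻¹ * γ, 1 + (1 + 2 * γ * α)⁻¹, 2 + 2 * γ * α, hγ, by positivity,
      lt_add_of_pos_right _ (by positivity), by linarith, hα, ?_, le_rfl, ?_, by ring⟩
    · linarith [mul_nonneg hγ.le hαβ]
    · rw [add_sub_cancel_left, show 2 + 2 * γ * α - 1 = 1 + 2 * γ * α by ring,
        inv_mul_cancel₀ hα.ne']
  · intro γ δ lam μ hγ hδ hlam hμ hα hμβ _ hprod hδγ
    have h1 : 0 < 1 + γ * α := by linarith
    have h2 : 0 < 1 + δ * β := by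
      have h3 : 1 + δ * β = (lam - 1) * (μ - 1 + γ * β) := by rw [hδγ, mul_add, hprod]; ring
      rw [h3]
      exact mul_pos (by linarith) (by linarith)
    exact ⟨h1, h2, hA.existsUnique_resolvent hγ h1, hB.existsUnique_resolvent hδ h2⟩
end

section
/- Let X be a real Hilbert space, let A: X ⇒ X be maximally α-monotone and B: X ⇒ X be maximally β-monotone with α + β ≥ 0 and zer(A+B) := {x : ∃ u ∈ A x with −u ∈ B x} nonempty. Let γ, δ > 0 and λ, μ > 1 satisfy 1 + 2γα > 0, 2 − 2γβ ≤ μ ≤ 2 + 2γα, (λ−1)(μ−1) = 1, δ = (λ−1)γ, and let κ ∈ (0,1). Let J₁, J₂: X → X be the (single-valued, everywhere-defined) resolvents, i.e., x − J₁x ∈ γ·A(J₁x) and x − J₂x ∈ δ·B(J₂x) for all x, and define R₁ := (1−λ)·Id + λ·J₁, R₂ := (1−μ)·Id + μ·J₂, T := (1−κ)·Id + κ·(R₂ ∘ R₁). Then for every x₀ ∈ X, the sequence x_{n+1} = T x_n: (i) converges weakly to some x̄ with T x̄ = x̄ (i.e., ⟨x_n, u⟩ → ⟨x̄, u⟩ for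 every u ∈ X) and J₁x̄ ∈ zer(A+B); (ii) satisfies √n·‖x_n − T x_n‖ → 0 as n → ∞; and (iii) if α + β > 0, then J₁x_n → J₁x̄ and J₂(R₁x_n) → J₁x̄ strongly (in norm), and zer(A+B) = {J₁x̄}. -/
open Pointwise RealInnerProductSpace Filter

variable {X : Type*} [NormedAddCommGroup X] [InnerProductSpace ℝ X]

/-- The terms of a summable antitone sequence of real numbers are `o(1 / n)`. -/
theorem Antitone.tendsto_natCast_mul_of_summable {a : ℕ → ℝ} (ha : Antitone a)
    (hs : Summable a) : Tendsto (fun n : ℕ => (n : ℝ) * a n) atTop (nhds 0) := by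
  have h_pos : ∀ n, 0 ≤ a n := ha.le_of_tendsto hs.tendsto_atTop_zero
  have hS := hs.hasSum.tendsto_sum_nat
  have h_half : Tendsto (fun n : ℕ => n / 2) atTop atTop := Nat.tendsto_div_const_atTop two_ne_zero
  have h_diff := ((hS.sub (hS.comp h_half)).const_mul 2)
  rw [sub_self, mul_zero] at h_diff
  refine squeeze_zero (fun n => mul_nonneg n.cast_nonneg (h_pos n)) (fun n => ?_) h_diff
  have h_le : n / 2 ≤ n := Nat.div_le_self n 2
  have h_sum : ((n - n / 2 : ℕ) : ℝ) * a n ≤ ∑ i ∈ Finset.Ico (n / 2) n, a i := by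
    have := Finset.card_nsmul_le_sum (Finset.Ico (n / 2) n) a (a n)
      fun i hi => ha (Finset.mem_Ico.1 hi).2.le
    simpa using this
  rw [Finset.sum_Ico_eq_sub _ h_le] at h_sum
  have h_card : (n : ℝ) ≤ 2 * ((n - n / 2 : ℕ) : ℝ) := by
    exact_mod_cast (by omega : n ≤ 2 * (n - n / 2))
  have := mul_le_mul_of_nonneg_right h_card (h_pos n)
  simp only [Function.comp_apply]
  linarith

/-- A nonnegative sequence dominated by the decrements of another nonnegative sequence is
summable. -/
theorem summable_of_le_sub_succ {a b : ℕ → ℝ} (ha : ∀ n, 0 ≤ a n) (hb : ∀ n, 0 ≤ b n)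
    (hab : ∀ n, a n ≤ b n - b (n + 1)) : Summable a := by
  refine summable_of_sum_range_le (c := b 0) ha fun n => ?_
  calc ∑ i ∈ Finset.range n, a i ≤ ∑ i ∈ Finset.range n, (b i - b (i + 1)) :=
        Finset.sum_le_sum fun i _ => hab i
    _ = b 0 - b n := Finset.sum_range_sub' b n
    _ ≤ b 0 := sub_le_self _ (hb n)

/-- Bounded families in a Hilbert space converge weakly along ultrafilters. -/
theorem exists_weak_limit_of_bounded [CompleteSpace X] {ι : Type*} (U : Ultrafilter ι)
    {x : ι → X} {C : ℝ} (hC : ∀ i, ‖x i‖ ≤ C) :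
    ∃ y : X, ∀ u : X, Tendsto (fun i => ⟪x i, u⟫) U (nhds ⟪y, u⟫) := by
  let f : ι → WeakDual ℝ X := fun i =>
    StrongDual.toWeakDual (InnerProductSpace.toDual ℝ X (x i))
  have hf : ∀ i, f i ∈ WeakDual.toStrongDual ⁻¹' Metric.closedBall (0 : StrongDual ℝ X) C := by
    intro i
    simpa [f] using hC i
  obtain ⟨φ, -, hφ⟩ := (WeakDual.isCompact_closedBall (𝕜 := ℝ) (0 : StrongDual ℝ X) C)
    |>.ultrafilter_le_nhds (U.map f)
    (by
      rw [le_principal_iff]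
      exact Filter.mem_map.2 (Filter.univ_mem' hf))
  have hφ' : Tendsto f U (nhds φ) := hφ
  rw [tendsto_iff_forall_eval_tendsto_topDualPairing] at hφ'
  refine ⟨(InnerProductSpace.toDual ℝ X).symm (WeakDual.toStrongDual φ), fun u => ?_⟩
  rw [InnerProductSpace.toDual_symm_apply]
  exact hφ' u

/-- **Demiclosedness principle** for nonexpansive maps. -/
theorem eq_of_weak_limit_of_nonexpansive {ι : Type*} {F : Filter ι} [F.NeBot] {N : X → X}
    (hN : ∀ x y, ‖N x - N y‖ ≤ ‖x - y‖) {x : ι → X} {y : X} {C : ℝ} (hC : ∀ i, ‖x i - y‖ ≤ C)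
    (hw : ∀ u : X, Tendsto (fun i => ⟪x i, u⟫) F (nhds ⟪y, u⟫))
    (hx : Tendsto (fun i => ‖x i - N (x i)‖) F (nhds 0)) : N y = y := by
  have h_le : ∀ i, ‖y - N y‖ ^ 2 ≤ ‖x i - N (x i)‖ ^ 2 + 2 * C * ‖x i - N (x i)‖
      - 2 * (⟪x i, y - N y⟫ - ⟪y, y - N y⟫) := by
    intro i
    have h_exp : ‖x i - N y‖ ^ 2 =
        ‖x i - y‖ ^ 2 + 2 * (⟪x i, y - N y⟫ - ⟪y, y - N y⟫) + ‖y - N y‖ ^ 2 := by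
      rw [← inner_sub_left, ← norm_add_sq_real, sub_add_sub_cancel]
    have h_tri : ‖x i - N y‖ ≤ ‖x i - N (x i)‖ + ‖x i - y‖ :=
      (norm_sub_le_norm_sub_add_norm_sub _ (N (x i)) _).trans (by gcongr; exact hN _ _)
    have h_sq := pow_le_pow_left₀ (norm_nonneg _) h_tri 2
    nlinarith [mul_le_mul_of_nonneg_right (hC i) (norm_nonneg (x i - N (x i)))]
  have h_lim : Tendsto (fun i => ‖x i - N (x i)‖ ^ 2 + 2 * C * ‖x i - N (x i)‖
      - 2 * (⟪x i, y - N y⟫ - ⟪y, y - N y⟫)) F (nhds 0) := by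
    simpa using ((hx.pow 2).add (hx.const_mul (2 * C))).sub
      (((hw (y - N y)).sub_const ⟪y, y - N y⟫).const_mul 2)
  have h_zero : ‖y - N y‖ ^ 2 ≤ 0 := ge_of_tendsto' h_lim h_le
  have h_norm : ‖y - N y‖ = 0 := pow_eq_zero_iff two_ne_zero |>.1 (le_antisymm h_zero (sq_nonneg _))
  exact (sub_eq_zero.1 (norm_eq_zero.1 h_norm)).symm

/-- **Opial's lemma** for Fejér monotone sequences. -/
theorem exists_weak_limit_of_fejer [CompleteSpace X] {S : Set X} (hS : S.Nonempty) {x : ℕ → X}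
    (hx : ∀ y ∈ S, Antitone fun n => ‖x n - y‖)
    (hcluster : ∀ (U : Ultrafilter ℕ) (y : X), (U : Filter ℕ) ≤ atTop →
      (∀ u : X, Tendsto (fun n => ⟪x n, u⟫) U (nhds ⟪y, u⟫)) → y ∈ S) :
    ∃ y ∈ S, ∀ u : X, Tendsto (fun n => ⟪x n, u⟫) atTop (nhds ⟪y, u⟫) := by
  obtain ⟨s, hs⟩ := hS
  have hC : ∀ n, ‖x n‖ ≤ ‖x 0 - s‖ + ‖s‖ := fun n =>
    (norm_le_norm_sub_add (x n) s).trans (by gcongr; exact hx s hs n.zero_le)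
  have h_dist : ∀ y ∈ S, ∃ l, Tendsto (fun n => ‖x n - y‖ ^ 2) atTop (nhds l) := fun y hy =>
    ⟨_, (tendsto_atTop_ciInf (hx y hy)
      ⟨0, by rintro _ ⟨n, rfl⟩; exact norm_nonneg _⟩).pow 2⟩
  have h_unique : ∀ (U V : Ultrafilter ℕ) (y z : X), (U : Filter ℕ) ≤ atTop →
      (V : Filter ℕ) ≤ atTop → (∀ u : X, Tendsto (fun n => ⟪x n, u⟫) U (nhds ⟪y, u⟫)) →
      (∀ u : X, Tendsto (fun n => ⟪x n, u⟫) V (nhds ⟪z, u⟫)) → y = z := by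
    intro U V y z hU hV hy hz
    obtain ⟨k, hk⟩ := h_dist y (hcluster U y hU hy)
    obtain ⟨l, hl⟩ := h_dist z (hcluster V z hV hz)
    have h_lim : Tendsto (fun n => ⟪x n, y - z⟫) atTop
        (nhds ((l - k + ‖y‖ ^ 2 - ‖z‖ ^ 2) / 2)) := by
      refine ((((hl.sub hk).add_const (‖y‖ ^ 2)).sub_const (‖z‖ ^ 2)).div_const 2).congr
        fun n => ?_
      rw [norm_sub_sq_real, norm_sub_sq_real, inner_sub_right]
      ring
    have h_eq : ⟪y, y - z⟫ = ⟪z, y - z⟫ :=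
      (tendsto_nhds_unique (hy _) (h_lim.mono_left hU)).trans
        (tendsto_nhds_unique (hz _) (h_lim.mono_left hV)).symm
    rw [← sub_eq_zero, ← inner_sub_left] at h_eq
    exact sub_eq_zero.1 (inner_self_eq_zero.1 h_eq)
  obtain ⟨y, hy⟩ := exists_weak_limit_of_bounded (Ultrafilter.of (atTop : Filter ℕ)) hC
  have hU := Ultrafilter.of_le (atTop : Filter ℕ)
  refine ⟨y, hcluster _ y hU hy, fun u => (tendsto_iff_ultrafilter _ _ _).2 fun V hV => ?_⟩
  obtain ⟨z, hz⟩ := exists_weak_limit_of_bounded V hC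
  rw [h_unique _ V y z hU hV hy hz]
  exact hz u

/-- The squared norm of an affine combination of two vectors. -/
theorem norm_sq_convex_comb (κ : ℝ) (p t : X) :
    ‖(1 - κ) • p + κ • t‖ ^ 2 =
      (1 - κ) * ‖p‖ ^ 2 + κ * ‖t‖ ^ 2 - κ * (1 - κ) * ‖p - t‖ ^ 2 := by
  rw [norm_add_sq_real, norm_sub_sq_real, norm_smul, norm_smul, inner_smul_left,
    inner_smul_right, mul_pow, mul_pow, Real.norm_eq_abs, Real.norm_eq_abs, sq_abs, sq_abs]
  simp only [conj_trivial]
  ring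

/-- **Krasnoselskii–Mann iteration**: weak convergence and the `o(1 / √n)` rate of asymptotic
regularity. -/
theorem krasnoselskii_mann [CompleteSpace X] {N T : X → X} {κ : ℝ} (hκ : κ ∈ Set.Ioo (0 : ℝ) 1)
    (hN : ∀ x y, ‖N x - N y‖ ≤ ‖x - y‖) (hfix : ∃ y, N y = y)
    (hT : ∀ z, T z = (1 - κ) • z + κ • N z) {x : ℕ → X} (hx : ∀ n, x (n + 1) = T (x n)) :
    ∃ y, N y = y ∧ (∀ u : X, Tendsto (fun n => ⟪x n, u⟫) atTop (nhds ⟪y, u⟫)) ∧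
      Tendsto (fun n : ℕ => Real.sqrt (n : ℝ) * ‖x n - T (x n)‖) atTop (nhds 0) := by
  obtain ⟨hκ0, hκ1⟩ := hκ
  have hκκ : 0 < κ * (1 - κ) := mul_pos hκ0 (sub_pos.2 hκ1)
  have h_step : ∀ y, N y = y → ∀ n,
      ‖x (n + 1) - y‖ ^ 2 ≤ ‖x n - y‖ ^ 2 - κ * (1 - κ) * ‖x n - N (x n)‖ ^ 2 := by
    intro y hy n
    have h_eq : x (n + 1) - y = (1 - κ) • (x n - y) + κ • (N (x n) - y) := by
      rw [hx, hT]
      module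
    have h_non : ‖N (x n) - y‖ ^ 2 ≤ ‖x n - y‖ ^ 2 := by
      have := hN (x n) y
      rw [hy] at this
      gcongr
    rw [h_eq, norm_sq_convex_comb, sub_sub_sub_cancel_right]
    nlinarith
  have h_fejer : ∀ y ∈ {y | N y = y}, Antitone fun n => ‖x n - y‖ := fun y hy =>
    antitone_nat_of_succ_le fun n => by
      refine le_of_sq_le_sq ?_ (norm_nonneg _)
      have := h_step y hy n
      have := mul_nonneg hκκ.le (sq_nonneg ‖x n - N (x n)‖)
      linarith
  obtain ⟨s, hs⟩ := hfix
  have h_diff : ∀ n, x n - T (x n) = κ • (x n - N (x n)) := fun n => by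
    rw [hT]
    module
  have h_res : Antitone fun n => ‖x n - N (x n)‖ := antitone_nat_of_succ_le fun n => by
    have h_eq : x (n + 1) - N (x (n + 1)) =
        (1 - κ) • (x n - N (x n)) + (N (x n) - N (x (n + 1))) := by
      nth_rewrite 1 [hx, hT]
      module
    have h_dist : ‖N (x n) - N (x (n + 1))‖ ≤ κ * ‖x n - N (x n)‖ := by
      refine (hN _ _).trans ?_
      rw [hx, h_diff, norm_smul, Real.norm_of_nonneg hκ0.le]
    rw [h_eq]
    refine (norm_add_le _ _).trans ?_
    rw [norm_smul, Real.norm_of_nonneg (sub_pos.2 hκ1).le]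
    linarith
  have h_res_sq : Antitone fun n => ‖x n - N (x n)‖ ^ 2 := fun m n hmn =>
    pow_le_pow_left₀ (norm_nonneg _) (h_res hmn) 2
  have h_sum : Summable fun n => ‖x n - N (x n)‖ ^ 2 := by
    rw [← summable_mul_left_iff hκκ.ne']
    refine summable_of_le_sub_succ (b := fun n => ‖x n - s‖ ^ 2) (fun n => by positivity)
      (fun n => by positivity) fun n => ?_
    have := h_step s hs n
    linarith
  have h_rate : Tendsto (fun n : ℕ => Real.sqrt n * ‖x n - N (x n)‖) atTop (nhds 0) := by
    have := (h_res_sq.tendsto_natCast_mul_of_summable h_sum).sqrt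
    rw [Real.sqrt_zero] at this
    refine this.congr fun n => ?_
    rw [Real.sqrt_mul n.cast_nonneg, Real.sqrt_sq (norm_nonneg _)]
  have h_zero : Tendsto (fun n => ‖x n - N (x n)‖) atTop (nhds 0) := by
    have := h_sum.tendsto_atTop_zero.sqrt
    rw [Real.sqrt_zero] at this
    exact this.congr fun n => Real.sqrt_sq (norm_nonneg _)
  obtain ⟨y, hy, hw⟩ := exists_weak_limit_of_fejer (S := {y | N y = y}) ⟨s, hs⟩ h_fejer
    fun U y hU hw =>
    eq_of_weak_limit_of_nonexpansive (C := ‖x 0 - s‖ + ‖s - y‖) hN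
      (fun n => (norm_sub_le_norm_sub_add_norm_sub _ s _).trans
        (by gcongr; exact h_fejer s hs n.zero_le)) hw (h_zero.mono_left hU)
  refine ⟨y, hy, hw, ?_⟩
  have := h_rate.const_mul κ
  rw [mul_zero] at this
  refine this.congr fun n => ?_
  rw [h_diff, norm_smul, Real.norm_of_nonneg hκ0.le]
  ring

/-- Monotonicity of `A` read through a selection of the resolvent of `γ • A`. -/
theorem AlphaMonotone.resolvent_inner_le {α γ : ℝ} {A : X → Set X} (hA : AlphaMonotone α A)
    (hγ : 0 < γ) {x y a b : X} (ha : x - a ∈ γ • A a) (hb : y - b ∈ γ • A b) :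
    γ * α * ‖a - b‖ ^ 2 ≤ ⟪a - b, (x - y) - (a - b)⟫ := by
  obtain ⟨u, hu, hux⟩ := ha
  obtain ⟨v, hv, hvy⟩ := hb
  have h_eq : (x - y) - (a - b) = γ • (u - v) := by
    rw [smul_sub]
    simp only at hux hvy
    rw [hux, hvy]
    abel
  rw [h_eq, inner_smul_right, mul_assoc]
  exact mul_le_mul_of_nonneg_left (hA hu hv) hγ.le

/-- The resolvent of `γ • A` is at most single-valued. -/
theorem AlphaMonotone.resolvent_unique {α γ : ℝ} {A : X → Set X} (hA : AlphaMonotone α A)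
    (hγ : 0 < γ) (hγα : 0 < 1 + γ * α) {x a b : X} (ha : x - a ∈ γ • A a)
    (hb : x - b ∈ γ • A b) : a = b := by
  have h := hA.resolvent_inner_le hγ ha hb
  rw [sub_self, zero_sub, inner_neg_right, real_inner_self_eq_norm_sq] at h
  have h_sq : ‖a - b‖ ^ 2 = 0 := by nlinarith [sq_nonneg ‖a - b‖]
  exact sub_eq_zero.1 (norm_eq_zero.1 (pow_eq_zero_iff two_ne_zero |>.1 h_sq))

/-- A sequence in a seminormed group tends to zero when a positive multiple of its squared norm is
dominated by a null sequence. -/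
theorem tendsto_zero_of_mul_norm_sq_le {E : Type*} [SeminormedAddCommGroup E]
    {a : ℕ → E} {s : ℕ → ℝ} {c : ℝ} (hc : 0 < c)
    (hs : Tendsto s atTop (nhds 0)) (h : ∀ n, c * ‖a n‖ ^ 2 ≤ s n) :
    Tendsto a atTop (nhds 0) := by
  have h_sq : Tendsto (fun n => ‖a n‖ ^ 2) atTop (nhds 0) := by
    refine squeeze_zero (fun n => sq_nonneg _) (fun n => ?_)
      (by simpa using hs.div_const c)
    rw [le_div_iff₀ hc, mul_comm]
    exact h n
  have h_sqrt := h_sq.sqrt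
  rw [Real.sqrt_zero] at h_sqrt
  exact tendsto_zero_iff_norm_tendsto_zero.2 (h_sqrt.congr fun n => Real.sqrt_sq (norm_nonneg _))

/-- Zeros of a sum of operators are unique when the sum is strongly monotone. -/
theorem AlphaMonotone.zero_unique {α β : ℝ} {A B : X → Set X} (hA : AlphaMonotone α A)
    (hB : AlphaMonotone β B) (hαβ : 0 < α + β) {y z u v : X} (hu : u ∈ A y) (hu' : -u ∈ B y)
    (hv : v ∈ A z) (hv' : -v ∈ B z) : y = z := by
  have h₁ := hA hu hv
  have h₂ := hB hu' hv'
  rw [neg_sub_neg, ← neg_sub u v, inner_neg_right] at h₂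
  have h_sq : ‖y - z‖ ^ 2 = 0 := by nlinarith [sq_nonneg ‖y - z‖]
  exact sub_eq_zero.1 (norm_eq_zero.1 (pow_eq_zero_iff two_ne_zero |>.1 h_sq))

/-- The estimate behind the adaptive Douglas–Rachford operator: `p` is a difference of points,
`a` and `b` the corresponding differences of first and second resolvents. -/
theorem norm_sq_sub_smul_sub_le {μ lam ca cb : ℝ} (hμ : 1 < μ) (h : (lam - 1) * (μ - 1) = 1)
    {p a b : X} (ha : ca * ‖a‖ ^ 2 ≤ ⟪a, p - a⟫)
    (hb : (lam - 1) * cb * ‖b‖ ^ 2 ≤ ⟪b, ((1 - lam) • p + lam • a) - b⟫) :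
    ‖p - μ • (a - b)‖ ^ 2 ≤
      ‖p‖ ^ 2 - μ * ((2 + 2 * ca - μ) * ‖a‖ ^ 2 + (μ - 2 + 2 * cb) * ‖b‖ ^ 2) := by
  have hμ1 : 0 < μ - 1 := sub_pos.2 hμ
  have hlam : (μ - 1) * lam = μ := by linear_combination h
  rw [inner_sub_right, real_inner_self_eq_norm_sq] at ha hb
  rw [inner_add_right, inner_smul_right, inner_smul_right] at hb
  have hb' := mul_le_mul_of_nonneg_left hb hμ1.le
  have hb'' : cb * ‖b‖ ^ 2 ≤ -⟪b, p⟫ + μ * ⟪b, a⟫ - (μ - 1) * ‖b‖ ^ 2 := by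
    linear_combination hb' - (cb * ‖b‖ ^ 2 + ⟪b, p⟫) * h + ⟪b, a⟫ * hlam
  rw [norm_sub_sq_real, inner_smul_right, norm_smul, mul_pow, Real.norm_eq_abs, sq_abs,
    norm_sub_sq_real, inner_sub_right, real_inner_comm a p, real_inner_comm b p,
    real_inner_comm b a]
  nlinarith [mul_le_mul_of_nonneg_left (add_le_add ha hb'') (by linarith : 0 ≤ 2 * μ)]

theorem stmt17 [CompleteSpace X] (A B : X → Set X) (α β : ℝ)
    (hA : MaxAlphaMonotone α A) (hB : MaxAlphaMonotone β B)
    (hαβ : 0 ≤ α + β)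
    (hzer : ∃ z : X, ∃ u ∈ A z, -u ∈ B z)
    (γ δ lam μ : ℝ) (hγ : 0 < γ) (hδ : 0 < δ) (hlam : 1 < lam) (hμ : 1 < μ)
    (h1 : 0 < 1 + 2 * γ * α) (h2 : 2 - 2 * γ * β ≤ μ) (h3 : μ ≤ 2 + 2 * γ * α)
    (h4 : (lam - 1) * (μ - 1) = 1) (h5 : δ = (lam - 1) * γ)
    (κ : ℝ) (hκ : κ ∈ Set.Ioo (0 : ℝ) 1)
    (J₁ J₂ : X → X)
    (hJ₁ : ∀ x, x - J₁ x ∈ γ • A (J₁ x)) (hJ₂ : ∀ x, x - J₂ x ∈ δ • B (J₂ x))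
    (R₁ R₂ T : X → X)
    (hR₁ : ∀ z, R₁ z = (1 - lam) • z + lam • J₁ z)
    (hR₂ : ∀ z, R₂ z = (1 - μ) • z + μ • J₂ z)
    (hT : ∀ z, T z = (1 - κ) • z + κ • R₂ (R₁ z))
    (x₀ : X) (x : ℕ → X) (hx0 : x 0 = x₀) (hx : ∀ n, x (n + 1) = T (x n)) :
    ∃ xbar : X, T xbar = xbar ∧
      (∀ u : X, Tendsto (fun n => ⟪x n, u⟫) atTop (nhds ⟪xbar, u⟫)) ∧
      (∃ u ∈ A (J₁ xbar), -u ∈ B (J₁ xbar)) ∧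
      Tendsto (fun n : ℕ => Real.sqrt (n : ℝ) * ‖x n - T (x n)‖) atTop (nhds 0) ∧
      (0 < α + β →
        Tendsto (fun n => J₁ (x n)) atTop (nhds (J₁ xbar)) ∧
        Tendsto (fun n => J₂ (R₁ (x n))) atTop (nhds (J₁ xbar)) ∧
        {z : X | ∃ u ∈ A z, -u ∈ B z} = {J₁ xbar}) := by
  obtain ⟨hκ0, hκ1⟩ := Set.mem_Ioo.1 hκ
  have hμ1 : 0 < μ - 1 := sub_pos.2 hμ
  have hμ0 : 0 < μ := by linarith
  have hlam1 : 0 < lam - 1 := sub_pos.2 hlam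
  have hγα : 0 < 1 + γ * α := by linarith
  have hδβ : 0 < 1 + δ * β := by
    have h : 0 < (μ - 1) + γ * β := by linarith
    have h' := mul_pos hlam1 h
    rw [h5]
    linarith
  have h_comp : ∀ z, R₂ (R₁ z) = z - μ • (J₁ z - J₂ (R₁ z)) := by
    intro z
    have h₁ : (1 - μ) * (1 - lam) = 1 := by linear_combination h4
    have h₂ : (1 - μ) * lam = -μ := by linear_combination -h4
    rw [hR₂]
    nth_rewrite 1 [hR₁ z]
    rw [smul_add, smul_smul, smul_smul, h₁, h₂]
    module
  have h_est : ∀ y z, ‖R₂ (R₁ y) - R₂ (R₁ z)‖ ^ 2 ≤ ‖y - z‖ ^ 2 -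
      μ * ((2 + 2 * (γ * α) - μ) * ‖J₁ y - J₁ z‖ ^ 2 +
        (μ - 2 + 2 * (γ * β)) * ‖J₂ (R₁ y) - J₂ (R₁ z)‖ ^ 2) := by
    intro y z
    have ha := hA.1.resolvent_inner_le hγ (hJ₁ y) (hJ₁ z)
    have hb := hB.1.resolvent_inner_le hδ (hJ₂ (R₁ y)) (hJ₂ (R₁ z))
    have h_refl : R₁ y - R₁ z = (1 - lam) • (y - z) + lam • (J₁ y - J₁ z) := by
      rw [hR₁, hR₁]
      module
    rw [h_refl, h5, mul_assoc (lam - 1)] at hb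
    have h_eq : R₂ (R₁ y) - R₂ (R₁ z) =
        (y - z) - μ • ((J₁ y - J₁ z) - (J₂ (R₁ y) - J₂ (R₁ z))) := by
      rw [h_comp, h_comp]
      module
    rw [h_eq]
    exact norm_sq_sub_smul_sub_le hμ h4 ha hb
  have hc₁ : 0 ≤ 2 + 2 * (γ * α) - μ := by linarith
  have hc₂ : 0 ≤ μ - 2 + 2 * (γ * β) := by linarith
  have h_non : ∀ y z, ‖R₂ (R₁ y) - R₂ (R₁ z)‖ ≤ ‖y - z‖ := by
    intro y z
    refine le_of_sq_le_sq ((h_est y z).trans (sub_le_self _ ?_)) (norm_nonneg _)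
    positivity
  have h_fix : ∃ y, R₂ (R₁ y) = y := by
    obtain ⟨z, u, hu, hu'⟩ := hzer
    have hJ₁z : J₁ (z + γ • u) = z := hA.1.resolvent_unique hγ hγα (hJ₁ _)
      (by rw [add_sub_cancel_left]; exact Set.smul_mem_smul_set hu)
    have hR₁z : R₁ (z + γ • u) = z + δ • -u := by
      rw [hR₁, hJ₁z, h5]
      module
    have hJ₂z : J₂ (z + δ • -u) = z := hB.1.resolvent_unique hδ hδβ (hJ₂ _)
      (by rw [add_sub_cancel_left]; exact Set.smul_mem_smul_set hu')
    refine ⟨z + γ • u, ?_⟩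
    rw [h_comp, hR₁z, hJ₁z, hJ₂z, sub_self, smul_zero, sub_zero]
  obtain ⟨y, hy, hw, h_rate⟩ := krasnoselskii_mann (N := fun z => R₂ (R₁ z)) hκ h_non h_fix hT hx
  have h_JJ : J₂ (R₁ y) = J₁ y := by
    have h := h_comp y
    rw [hy, eq_comm, sub_eq_self, smul_eq_zero_iff_right hμ0.ne', sub_eq_zero] at h
    exact h.symm
  have h_zero : ∃ u ∈ A (J₁ y), -u ∈ B (J₁ y) := by
    obtain ⟨u, hu, hu'⟩ := hJ₁ y
    obtain ⟨v, hv, hv'⟩ := hJ₂ (R₁ y)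
    rw [h_JJ] at hv hv'
    simp only at hu' hv'
    have h_eq : δ • v = δ • -u := by
      rw [hv', hR₁, h5, smul_neg, mul_smul, hu']
      module
    rw [smul_right_injective X hδ.ne' h_eq] at hv
    exact ⟨u, hu, hv⟩
  refine ⟨y, ?_, hw, h_zero, h_rate, fun hpos => ?_⟩
  · rw [hT, hy]
    module
  set a : ℕ → X := fun n => J₁ (x n) - J₁ y with ha_def
  set b : ℕ → X := fun n => J₂ (R₁ (x n)) - J₁ y with hb_def
  have h_step : ∀ n, κ * μ * ((2 + 2 * (γ * α) - μ) * ‖a n‖ ^ 2 +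
      (μ - 2 + 2 * (γ * β)) * ‖b n‖ ^ 2) + κ * (1 - κ) * μ ^ 2 * ‖a n - b n‖ ^ 2 ≤
      ‖x n - y‖ ^ 2 - ‖x (n + 1) - y‖ ^ 2 := by
    intro n
    have h_eq : x (n + 1) - y = (1 - κ) • (x n - y) + κ • (R₂ (R₁ (x n)) - R₂ (R₁ y)) := by
      rw [hx, hT, hy]
      module
    have h_diff : (x n - y) - (R₂ (R₁ (x n)) - R₂ (R₁ y)) = μ • (a n - b n) := by
      rw [hy, h_comp, ha_def, hb_def]
      module
    have h := h_est (x n) y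
    rw [h_JJ] at h
    rw [h_eq, norm_sq_convex_comb, h_diff, norm_smul, mul_pow, Real.norm_eq_abs, sq_abs]
    linear_combination κ * h
  have hd : 0 < κ * (1 - κ) * μ ^ 2 :=
    mul_pos (mul_pos hκ0 (sub_pos.2 hκ1)) (pow_pos hμ0 2)
  have hκμ : 0 < κ * μ := mul_pos hκ0 hμ0
  have h_term₁ : ∀ n, 0 ≤ κ * μ * ((2 + 2 * (γ * α) - μ) * ‖a n‖ ^ 2) := fun n =>
    mul_nonneg hκμ.le (mul_nonneg hc₁ (sq_nonneg _))
  have h_term₂ : ∀ n, 0 ≤ κ * μ * ((μ - 2 + 2 * (γ * β)) * ‖b n‖ ^ 2) := fun n =>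
    mul_nonneg hκμ.le (mul_nonneg hc₂ (sq_nonneg _))
  have h_term₃ : ∀ n, 0 ≤ κ * (1 - κ) * μ ^ 2 * ‖a n - b n‖ ^ 2 := fun n =>
    mul_nonneg hd.le (sq_nonneg _)
  have h_lim := (summable_of_le_sub_succ (b := fun n => ‖x n - y‖ ^ 2)
    (fun n => by linarith [h_term₁ n, h_term₂ n, h_term₃ n]) (fun n => sq_nonneg _)
    h_step).tendsto_atTop_zero
  have h_ab : Tendsto (fun n => a n - b n) atTop (nhds 0) :=
    tendsto_zero_of_mul_norm_sq_le hd h_lim fun n => by linarith [h_term₁ n, h_term₂ n]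
  have h_both : Tendsto a atTop (nhds 0) ∧ Tendsto b atTop (nhds 0) := by
    rcases hc₁.lt_or_eq with hc | hc
    · have h_a : Tendsto a atTop (nhds 0) :=
        tendsto_zero_of_mul_norm_sq_le (mul_pos hκμ hc) h_lim fun n => by
          linarith [h_term₂ n, h_term₃ n]
      exact ⟨h_a, by simpa using h_a.sub h_ab⟩
    · have hc' : 0 < μ - 2 + 2 * (γ * β) := by linarith [mul_pos hγ hpos]
      have h_b : Tendsto b atTop (nhds 0) :=
        tendsto_zero_of_mul_norm_sq_le (mul_pos hκμ hc') h_lim fun n => by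
          linarith [h_term₁ n, h_term₃ n]
      exact ⟨by simpa using h_ab.add h_b, h_b⟩
  refine ⟨tendsto_sub_nhds_zero_iff.1 h_both.1, tendsto_sub_nhds_zero_iff.1 h_both.2, ?_⟩
  obtain ⟨u, hu, hu'⟩ := h_zero
  refine Set.eq_singleton_iff_unique_mem.2 ⟨⟨u, hu, hu'⟩, ?_⟩
  rintro z ⟨v, hv, hv'⟩
  exact hA.1.zero_unique hB.1 hpos hv hv' hu hu'
end
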